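/- For all weights x, y > 0, the weighted connective constant of self-avoiding trails on the square lattice satisfies μ^T(x,y) ≤ 2^{−1/2}·[x² + 8xy + y² + (x + y)·√(x² + 14xy + y²)]^{1/2}. -/

import Mathlib

open scoped BigOperators

def sqStep : Fin 4 → ℤ × ℤ
  | 0 => (1, 0)
  | 1 => (-1, 0)
  | 2 => (0, 1)
  | 3 => (0, -1)

/-- Position of the walk after `i` steps, starting at the origin. -/
def sqPos {n : ℕ} (ω : Fin n → Fin 4) (i : Fin (n + 1)) : ℤ × ℤ :=
  ∑ j : Fin n, if (j : ℕ) < (i : ℕ) then sqStep (ω j) else 0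

/-- A walk is a self-avoiding trail if its undirected edges are pairwise distinct. -/
def sqIsSAT {n : ℕ} (ω : Fin n → Fin 4) : Prop :=
  Function.Injective (fun i : Fin n => s(sqPos ω i.castSucc, sqPos ω i.succ))

/-- Number of horizontal steps. -/
def sqNh {n : ℕ} (ω : Fin n → Fin 4) : ℕ :=
  (Finset.univ.filter fun j => ω j = 0 ∨ ω j = 1).card

/-- Number of vertical steps. -/
def sqNv {n : ℕ} (ω : Fin n → Fin 4) : ℕ :=
  (Finset.univ.filter fun j => ω j = 2 ∨ ω j = 3).card

/-- Weight `x^{N_h} y^{N_v}` of a walk. -/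
noncomputable def sqWeight (x y : ℝ) {n : ℕ} (ω : Fin n → Fin 4) : ℝ :=
  x ^ sqNh ω * y ^ sqNv ω

/- `satCount n x y` is `c^T_n(x,y)`: the sum of the weights of all `n`-step
self-avoiding trails starting at the origin. -/
open Classical in
noncomputable def satCount (n : ℕ) (x y : ℝ) : ℝ :=
  ∑ ω ∈ Finset.univ.filter (fun ω : Fin n → Fin 4 => sqIsSAT ω), sqWeight x y ω

/-- The weighted connective constant `μ^T(x,y) = inf_{n ≥ 1} c^T_n(x,y)^{1/n}`. -/
noncomputable def satMu (x y : ℝ) : ℝ :=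
  ⨅ n : ℕ, satCount (n + 1) x y ^ (1 / (n + 1 : ℝ))

/-- Weight of a single step. -/
noncomputable def stepWeight (x y : ℝ) (i : Fin 4) : ℝ := if i = 0 ∨ i = 1 then x else y

/-- Transfer matrix of non-backtracking walks. -/
noncomputable def nbKernel (x y : ℝ) (i j : Fin 4) : ℝ :=
  if sqStep j = -sqStep i then 0 else stepWeight x y j

/-- Perron eigenvalue of the non-backtracking transfer matrix. -/
noncomputable def nbEigenvalue (x y : ℝ) : ℝ :=
  (x + y + Real.sqrt (x ^ 2 + 14 * x * y + y ^ 2)) / 2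

/-- Perron eigenvector of the non-backtracking transfer matrix. -/
noncomputable def nbEigenvector (x y : ℝ) (i : Fin 4) : ℝ :=
  if i = 0 ∨ i = 1 then 2 * y else nbEigenvalue x y - x

lemma sqWeight_eq_prod (x y : ℝ) {n : ℕ} (ω : Fin n → Fin 4) :
    sqWeight x y ω = ∏ j, stepWeight x y (ω j) := by
  have h : ∀ i : Fin 4, (i = 2 ∨ i = 3) ↔ ¬(i = 0 ∨ i = 1) := by decide
  simp only [sqWeight, sqNh, sqNv, stepWeight, Finset.prod_ite, Finset.prod_const, h]

lemma stepWeight_pos {x y : ℝ} (hx : 0 < x) (hy : 0 < y) (i : Fin 4) :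
    0 < stepWeight x y i := by
  unfold stepWeight; split_ifs <;> assumption

lemma nbKernel_nonneg {x y : ℝ} (hx : 0 < x) (hy : 0 < y) (i j : Fin 4) :
    0 ≤ nbKernel x y i j := by
  unfold nbKernel
  split_ifs
  · exact le_rfl
  · exact (stepWeight_pos hx hy j).le

lemma sqPos_succ {n : ℕ} (ω : Fin n → Fin 4) (i : Fin n) :
    sqPos ω i.succ = sqPos ω i.castSucc + sqStep (ω i) := by
  have h : sqStep (ω i) = ∑ j : Fin n, if j = i then sqStep (ω j) else 0 := by simp
  unfold sqPos
  rw [h, ← Finset.sum_add_distrib]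
  refine Finset.sum_congr rfl fun j _ => ?_
  simp only [Fin.val_succ, Fin.val_castSucc, Fin.ext_iff]
  rcases lt_trichotomy (j : ℕ) i with h | h | h
  · simp [h, h.ne, Nat.lt_succ_of_lt h]
  · simp [h]
  · simp [h.ne', h.not_gt, Nat.not_lt.mpr (Nat.succ_le_of_lt h)]

/-- A self-avoiding trail never reverses its previous step. -/
lemma sqIsSAT.step_ne_neg {n : ℕ} {ω : Fin (n + 1) → Fin 4} (h : sqIsSAT ω) (k : Fin n) :
    sqStep (ω k.succ) ≠ -sqStep (ω k.castSucc) := by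
  intro hk
  refine (Fin.castSucc_lt_succ (i := k)).ne (h ?_)
  have h1 := sqPos_succ ω k.castSucc
  have h2 := sqPos_succ ω k.succ
  rw [← Fin.succ_castSucc, hk, h1, add_neg_cancel_right] at h2
  simp only [← Fin.succ_castSucc, h2]
  exact Sym2.eq_swap

lemma sqWeight_eq_prod_nbKernel (x y : ℝ) {n : ℕ} {ω : Fin (n + 1) → Fin 4} (h : sqIsSAT ω) :
    sqWeight x y ω =
      stepWeight x y (ω 0) * ∏ k : Fin n, nbKernel x y (ω k.castSucc) (ω k.succ) := by
  rw [sqWeight_eq_prod, Fin.prod_univ_succ]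
  congr 1
  exact Finset.prod_congr rfl fun k _ => (if_neg (h.step_ne_neg k)).symm

lemma nbEigenvalue_sq {x y : ℝ} (hx : 0 < x) (hy : 0 < y) :
    nbEigenvalue x y ^ 2 = (x + y) * nbEigenvalue x y + 3 * x * y := by
  have := Real.sq_sqrt (show 0 ≤ x ^ 2 + 14 * x * y + y ^ 2 by positivity)
  unfold nbEigenvalue
  linear_combination this / 4

lemma lt_nbEigenvalue {x y : ℝ} (hx : 0 < x) (hy : 0 < y) : x < nbEigenvalue x y := by
  have h : x < Real.sqrt (x ^ 2 + 14 * x * y + y ^ 2) :=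
    Real.lt_sqrt_of_sq_lt (by nlinarith [mul_pos hx hy])
  unfold nbEigenvalue
  linarith

lemma nbEigenvector_pos {x y : ℝ} (hx : 0 < x) (hy : 0 < y) (i : Fin 4) :
    0 < nbEigenvector x y i := by
  have := lt_nbEigenvalue hx hy
  unfold nbEigenvector
  split_ifs <;> linarith

lemma sum_nbKernel_mul_nbEigenvector {x y : ℝ} (hx : 0 < x) (hy : 0 < y) (i : Fin 4) :
    ∑ j, nbKernel x y i j * nbEigenvector x y j = nbEigenvalue x y * nbEigenvector x y i := by
  have := nbEigenvalue_sq hx hy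
  fin_cases i <;>
    simp [Fin.sum_univ_four, nbKernel, nbEigenvector, stepWeight, sqStep] <;>
    linarith

/-- Iterating a transfer matrix with an eigenvector, as a sum over words. -/
lemma sum_prod_kernel_mul_eigenvector {ι : Type*} [Fintype ι] {K : ι → ι → ℝ} {f : ι → ℝ}
    {c : ℝ} (h : ∀ i, ∑ j, K i j * f j = c * f i) (g : ι → ℝ) (n : ℕ) :
    ∑ ω : Fin (n + 1) → ι, g (ω 0) * (∏ k : Fin n, K (ω k.castSucc) (ω k.succ)) *
      f (ω (Fin.last n)) = (∑ i, g i * f i) * c ^ n := by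
  induction n with
  | zero =>
    rw [← (Equiv.funUnique (Fin 1) ι).symm.sum_comp]
    simp
  | succ n ih =>
    rw [pow_succ, ← mul_assoc, ← ih, Finset.sum_mul,
      ← (Fin.snocEquiv fun _ : Fin (n + 2) => ι).sum_comp, Fintype.sum_prod_type_right]
    refine Finset.sum_congr rfl fun ω _ => ?_
    have h0 : ∀ i : ι, (Fin.snoc ω i : Fin (n + 2) → ι) 0 = ω 0 := fun i =>
      Fin.snoc_castSucc (α := fun _ => ι) i ω 0
    simp only [Fin.snocEquiv_apply, Fin.prod_univ_castSucc, Fin.succ_castSucc, Fin.succ_last,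
      Fin.snoc_castSucc, Fin.snoc_last, h0]
    rw [mul_assoc _ (f _), mul_comm (f _), ← h, Finset.mul_sum]
    exact Finset.sum_congr rfl fun i _ => by ring

lemma satCount_nonneg {x y : ℝ} (hx : 0 < x) (hy : 0 < y) (n : ℕ) : 0 ≤ satCount n x y :=
  Finset.sum_nonneg fun _ _ => by unfold sqWeight; positivity

lemma exists_satCount_le {x y : ℝ} (hx : 0 < x) (hy : 0 < y) :
    ∃ C > 0, ∀ n, satCount (n + 1) x y ≤ C * nbEigenvalue x y ^ (n + 1) := by
  classical
  have hl : 0 < nbEigenvalue x y := hx.trans (lt_nbEigenvalue hx hy)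
  obtain ⟨i₀, hi₀⟩ := Finite.exists_min (nbEigenvector x y)
  have hm := nbEigenvector_pos hx hy i₀
  have hS : 0 < ∑ i, stepWeight x y i * nbEigenvector x y i :=
    Finset.sum_pos (fun i _ => mul_pos (stepWeight_pos hx hy i) (nbEigenvector_pos hx hy i))
      Finset.univ_nonempty
  refine ⟨(∑ i, stepWeight x y i * nbEigenvector x y i) /
    (nbEigenvector x y i₀ * nbEigenvalue x y), by positivity, fun n => ?_⟩
  have key : satCount (n + 1) x y * nbEigenvector x y i₀ ≤
      (∑ i, stepWeight x y i * nbEigenvector x y i) * nbEigenvalue x y ^ n := by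
    rw [← sum_prod_kernel_mul_eigenvector (sum_nbKernel_mul_nbEigenvector hx hy), satCount,
      Finset.sum_mul]
    have hnn (ω : Fin (n + 1) → Fin 4) : 0 ≤ stepWeight x y (ω 0) *
        ∏ k : Fin n, nbKernel x y (ω k.castSucc) (ω k.succ) :=
      mul_nonneg (stepWeight_pos hx hy _).le
        (Finset.prod_nonneg fun k _ => nbKernel_nonneg hx hy _ _)
    refine (Finset.sum_le_sum fun ω hω => ?_).trans
      (Finset.sum_le_sum_of_subset_of_nonneg (Finset.filter_subset _ _) fun ω _ _ =>
        mul_nonneg (hnn ω) (nbEigenvector_pos hx hy _).le)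
    rw [sqWeight_eq_prod_nbKernel x y (Finset.mem_filter.mp hω).2]
    exact mul_le_mul_of_nonneg_left (hi₀ _) (hnn ω)
  rw [← le_div_iff₀ hm] at key
  refine key.trans_eq ?_
  rw [pow_succ]
  field_simp

lemma satMu_le_nbEigenvalue {x y : ℝ} (hx : 0 < x) (hy : 0 < y) :
    satMu x y ≤ nbEigenvalue x y := by
  have hl : 0 < nbEigenvalue x y := hx.trans (lt_nbEigenvalue hx hy)
  obtain ⟨C, hC, h⟩ := exists_satCount_le hx hy
  have hbdd : BddBelow (Set.range fun n : ℕ => satCount (n + 1) x y ^ (1 / (n + 1 : ℝ))) :=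
    ⟨0, by rintro _ ⟨n, rfl⟩; exact Real.rpow_nonneg (satCount_nonneg hx hy _) _⟩
  have hle (n : ℕ) : satMu x y ≤ C ^ (1 / (n + 1 : ℝ)) * nbEigenvalue x y := by
    refine (ciInf_le hbdd n).trans ((Real.rpow_le_rpow (satCount_nonneg hx hy _) (h n)
      (by positivity)).trans_eq ?_)
    rw [Real.mul_rpow hC.le (by positivity), ← Real.rpow_natCast, ← Real.rpow_mul hl.le]
    have : ((n + 1 : ℕ) : ℝ) * (1 / (n + 1 : ℝ)) = 1 := by push_cast; field_simp
    rw [this, Real.rpow_one]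
  have hlim := (Real.continuousAt_const_rpow (b := 0) hC.ne').tendsto.comp
    (tendsto_one_div_add_atTop_nhds_zero_nat (𝕜 := ℝ))
  refine ge_of_tendsto' (x := Filter.atTop) ?_ hle
  simpa [Function.comp_def] using hlim.mul_const (nbEigenvalue x y)

lemma bound_eq_nbEigenvalue {x y : ℝ} (hx : 0 < x) (hy : 0 < y) :
    (2 : ℝ) ^ (-(1 / 2 : ℝ)) *
      (x ^ 2 + 8 * x * y + y ^ 2 +
        (x + y) * Real.sqrt (x ^ 2 + 14 * x * y + y ^ 2)) ^ (1 / 2 : ℝ) = nbEigenvalue x y := by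
  have hl : 0 < nbEigenvalue x y := hx.trans (lt_nbEigenvalue hx hy)
  have h : x ^ 2 + 8 * x * y + y ^ 2 + (x + y) * Real.sqrt (x ^ 2 + 14 * x * y + y ^ 2) =
      2 * nbEigenvalue x y ^ 2 := by
    rw [nbEigenvalue_sq hx hy, nbEigenvalue]
    ring
  rw [h, Real.mul_rpow (by norm_num) (by positivity), ← mul_assoc,
    ← Real.rpow_add (by norm_num), ← Real.sqrt_eq_rpow, Real.sqrt_sq hl.le]
  norm_num

theorem satMu_le_bound_m1_n3 (x y : ℝ) (hx : 0 < x) (hy : 0 < y) :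
    satMu x y ≤ (2 : ℝ) ^ (-(1 / 2 : ℝ)) *
      (x ^ 2 + 8 * x * y + y ^ 2 +
        (x + y) * Real.sqrt (x ^ 2 + 14 * x * y + y ^ 2)) ^ (1 / 2 : ℝ) := by
  rw [bound_eq_nbEigenvalue hx hy]
  exact satMu_le_nbEigenvalue hx hy
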